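/- arXiv:2402.14759 — 6 statements merged into one kernel-verified Lean document; each statement's English description precedes it below -/
import Mathlib

section
/- Let H be a finite, nonempty class of measurable hypotheses h : X → Y, let l be the zero-one loss l((x,y),h) = 1[h(x) ≠ y], let p* be any probability distribution over X × Y, and let the training set D = ((x_1,y_1),…,(x_n,y_n)) consist of n i.i.d. samples from p*. Assume realisability: there exists h* ∈ H with expected risk L(h*) = 0. Let ĥ be any empirical risk minimiser over H for D. Then for every δ ∈ (0,1), with probability at least 1 − δ over the draw of the training set, L(ĥ) ≤ (log|H| + log(1/δ))/n. -/
open MeasureTheory Real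

variable {X Y : Type*} [MeasurableSpace X] [MeasurableSpace Y]

/-- Expected risk of a hypothesis `h : X → Y` under the zero-one loss, for a data
distribution `p` on `X × Y`: `L(h) = p {(x,y) : h x ≠ y}`. -/
noncomputable def expectedRisk01 (p : Measure (X × Y)) (h : X → Y) : ℝ :=
  (p {z : X × Y | h z.1 ≠ z.2}).toReal

/-- Empirical risk of a hypothesis `h : X → Y` under the zero-one loss, for a training
set `D = ((x₁,y₁),…,(xₙ,yₙ))`: `L̂(h) = (1/n) ∑ᵢ 1[h xᵢ ≠ yᵢ]`. -/
noncomputable def empiricalRisk01 {n : ℕ} (D : Fin n → X × Y) (h : X → Y) : ℝ :=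
  (n : ℝ)⁻¹ * ∑ i, ({z : X × Y | h z.1 ≠ z.2}).indicator (fun _ => (1 : ℝ)) (D i)

/-- If `h` misclassifies no sample of a training set, its empirical risk is zero. -/
lemma empiricalRisk01_eq_zero {X Y : Type*} {n : ℕ} {D : Fin n → X × Y} {h : X → Y}
    (hD : ∀ i, h (D i).1 = (D i).2) : empiricalRisk01 D h = 0 := by
  simp [empiricalRisk01, hD]

/-- A hypothesis of zero empirical risk misclassifies no sample. -/
lemma eq_of_empiricalRisk01_nonpos {X Y : Type*} {n : ℕ} (hn : 0 < n)
    {D : Fin n → X × Y} {h : X → Y} (hD : empiricalRisk01 D h ≤ 0) (i : Fin n) :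
    h (D i).1 = (D i).2 := by
  by_contra hi
  refine hD.not_gt (mul_pos (by positivity) (Finset.sum_pos' (fun j _ => ?_)
    ⟨i, Finset.mem_univ i, ?_⟩))
  · exact Set.indicator_nonneg (fun _ _ => zero_le_one) _
  · rw [Set.indicator_of_mem (by exact hi)]
    exact one_pos

/-- The probability that a hypothesis of expected risk at least `ε` correctly classifies `n`
independent samples is at most `exp (-(n * ε))`. -/
lemma pi_real_forall_eq_le_exp {n : ℕ} (p : Measure (X × Y)) [IsProbabilityMeasure p]
    {h : X → Y} (hh : MeasurableSet {z : X × Y | h z.1 ≠ z.2}) {ε : ℝ}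
    (hε : ε ≤ expectedRisk01 p h) :
    (Measure.pi fun _ : Fin n => p).real
      (Set.univ.pi fun _ => {z : X × Y | h z.1 ≠ z.2}ᶜ) ≤ Real.exp (-(n * ε)) := by
  have hc : p.real {z : X × Y | h z.1 ≠ z.2}ᶜ ≤ Real.exp (-ε) := by
    rw [probReal_compl_eq_one_sub hh]
    have h1 := Real.add_one_le_exp (-ε)
    change ε ≤ p.real _ at hε
    linarith
  calc (Measure.pi fun _ : Fin n => p).real (Set.univ.pi fun _ => {z : X × Y | h z.1 ≠ z.2}ᶜ)
      = p.real {z : X × Y | h z.1 ≠ z.2}ᶜ ^ n := by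
        simp only [Measure.real, Measure.pi_pi, Finset.prod_const, Finset.card_univ,
          Fintype.card_fin, ENNReal.toReal_pow]
    _ ≤ Real.exp (-ε) ^ n := pow_le_pow_left₀ measureReal_nonneg hc n
    _ = Real.exp (-(n * ε)) := by rw [← Real.exp_nat_mul, mul_neg]

/-- **PAC bound for finite, realisable hypothesis classes.**
If `H` is a finite nonempty class of measurable hypotheses, the data distribution `p` is a
probability measure on `X × Y`, realisability holds (some `h* ∈ H` has zero expected risk),
and `ĥ` is any empirical risk minimiser over `H` for the i.i.d. training set of size `n`,
then with probability at least `1 - δ` over the draw of the training set,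
`L(ĥ) ≤ (log |H| + log (1/δ)) / n`. -/
theorem pac_finite_realisable
    {n : ℕ} (hn : 0 < n)
    (H : Finset (X → Y)) (hH : H.Nonempty)
    (hmeas : ∀ h ∈ H, Measurable h ∧ MeasurableSet {z : X × Y | h z.1 ≠ z.2})
    (p : Measure (X × Y)) [IsProbabilityMeasure p]
    (hrealisable : ∃ h ∈ H, expectedRisk01 p h = 0)
    (erm : (Fin n → X × Y) → X → Y)
    (herm : ∀ D : Fin n → X × Y,
      erm D ∈ H ∧ ∀ h ∈ H, empiricalRisk01 D (erm D) ≤ empiricalRisk01 D h)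
    (δ : ℝ) (hδ : δ ∈ Set.Ioo (0 : ℝ) 1) :
    1 - δ ≤
      ((Measure.pi fun _ : Fin n => p)
        {D | expectedRisk01 p (erm D) ≤ (Real.log H.card + Real.log (1 / δ)) / n}).toReal := by
  classical
  obtain ⟨g, hg, hg0⟩ := hrealisable
  set ε : ℝ := (Real.log H.card + Real.log (1 / δ)) / n with hε
  set P := Measure.pi fun _ : Fin n => p
  set consistent : (X → Y) → Set (Fin n → X × Y) :=
    fun h => Set.univ.pi fun _ => {z : X × Y | h z.1 ≠ z.2}ᶜ
  have hmeas_cons : ∀ h ∈ H, MeasurableSet (consistent h) := fun h hh =>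
    MeasurableSet.univ_pi fun _ => (hmeas h hh).2.compl
  set B := H.filter fun h => ε < expectedRisk01 p h
  have hBH : B ⊆ H := Finset.filter_subset _ _
  set bad := ⋃ h ∈ B, consistent h
  have hbad_meas : MeasurableSet bad :=
    B.measurableSet_biUnion fun h hh => hmeas_cons h (hBH hh)
  have hcard : (0 : ℝ) < H.card := by exact_mod_cast hH.card_pos
  have hexp : Real.exp (-(n * ε)) = δ / H.card := by
    have hn' : (n : ℝ) ≠ 0 := by positivity
    rw [hε, mul_div_cancel₀ _ hn', one_div, Real.log_inv, neg_add, neg_neg, Real.exp_add,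
      Real.exp_neg, Real.exp_log hcard, Real.exp_log hδ.1]
    ring
  have hbad_le : P.real bad ≤ δ :=
    calc P.real bad ≤ ∑ h ∈ B, P.real (consistent h) := measureReal_biUnion_finset_le _ _
      _ ≤ ∑ _h ∈ B, δ / H.card := Finset.sum_le_sum fun h hh =>
          (pi_real_forall_eq_le_exp p (hmeas h (hBH hh)).2
            (Finset.mem_filter.1 hh).2.le).trans_eq hexp
      _ ≤ ∑ _h ∈ H, δ / H.card :=
          Finset.sum_le_sum_of_subset_of_nonneg hBH fun _ _ _ => div_nonneg hδ.1.le hcard.le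
      _ = δ := by
          rw [Finset.sum_const, nsmul_eq_mul, mul_div_cancel₀ _ hcard.ne']
  have hg_null : p {z : X × Y | g z.1 ≠ z.2} = 0 :=
    (ENNReal.toReal_eq_zero_iff _).1 hg0 |>.resolve_right (measure_ne_top _ _)
  have hg_ae : ∀ᵐ D ∂P, ∀ i, g (D i).1 = (D i).2 :=
    ae_all_iff.2 fun i =>
      (Measure.tendsto_eval_ae_ae (μ := fun _ : Fin n => p) (i := i)).eventually
        (p := fun z : X × Y => g z.1 = z.2) (ae_iff.2 hg_null)
  have hsub : badᶜ ≤ᵐ[P] {D | expectedRisk01 p (erm D) ≤ ε} := by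
    filter_upwards [hg_ae] with D hD hDbad
    by_contra hlt
    have hrisk : ε < expectedRisk01 p (erm D) := not_le.1 hlt
    have hzero := ((herm D).2 g hg).trans_eq (empiricalRisk01_eq_zero hD)
    exact hDbad (Set.mem_biUnion (Finset.mem_filter.2 ⟨(herm D).1, hrisk⟩)
      fun i _ => not_not.2 (eq_of_empiricalRisk01_nonpos hn hzero i))
  calc 1 - δ ≤ 1 - P.real bad := by linarith
    _ = P.real badᶜ := (probReal_compl_eq_one_sub hbad_meas).symm
    _ ≤ P.real {D | expectedRisk01 p (erm D) ≤ ε} :=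
        ENNReal.toReal_mono (measure_ne_top _ _) (measure_mono_ae hsub)
end

section
/- Let H be a finite, nonempty class of measurable hypotheses h : X → Y, l the zero-one loss, p* a probability distribution over X × Y from which n i.i.d. training samples are drawn, and assume realisability (there exists h* ∈ H with L(h*) = 0). Let ĥ be any empirical risk minimiser. Then for every ε > 0, the probability over the draw of the training set that L(ĥ) > ε is at most |H| · e^{−εn}. -/
open MeasureTheory Real

variable {X Y : Type*} [MeasurableSpace X] [MeasurableSpace Y]

/-- The probability that `n` independent samples all avoid an event `S` of probability at least `ε`
is at most `exp (-(ε * n))`. -/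
theorem measureReal_pi_compl_le_exp {Z : Type*} [MeasurableSpace Z] (p : Measure Z)
    [IsProbabilityMeasure p] {S : Set Z} (hS : MeasurableSet S) {ε : ℝ} (hε : ε ≤ p.real S)
    (n : ℕ) :
    (Measure.pi fun _ : Fin n => p).real {D | ∀ i, D i ∉ S} ≤ Real.exp (-(ε * n)) := by
  have hset : {D : Fin n → Z | ∀ i, D i ∉ S} = Set.univ.pi fun _ => Sᶜ := by
    ext D
    simp
  have hcompl : p.real Sᶜ ≤ Real.exp (-ε) := by
    rw [probReal_compl_eq_one_sub hS]
    linarith [Real.add_one_le_exp (-ε)]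
  calc (Measure.pi fun _ : Fin n => p).real {D | ∀ i, D i ∉ S}
      = p.real Sᶜ ^ n := by
        rw [hset, measureReal_def, Measure.pi_pi]
        simp [measureReal_def]
    _ ≤ Real.exp (-ε) ^ n := pow_le_pow_left₀ measureReal_nonneg hcompl n
    _ = Real.exp (-(ε * n)) := by
        rw [← Real.exp_nat_mul]
        ring_nf

/-- Almost surely, no sample falls into a null set. -/
theorem ae_pi_forall_notMem {Z : Type*} [MeasurableSpace Z] (p : Measure Z)
    [IsProbabilityMeasure p] {S : Set Z} (hS : p S = 0) (n : ℕ) :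
    ∀ᵐ D ∂(Measure.pi fun _ : Fin n => p), ∀ i, D i ∉ S := by
  rw [ae_all_iff]
  intro i
  exact (measurePreserving_eval (fun _ : Fin n => p) i).quasiMeasurePreserving.ae
    (measure_eq_zero_iff_ae_notMem.1 hS)

theorem empiricalRisk01_eq_zero_of_forall {X Y : Type*} {n : ℕ}
    {D : Fin n → X × Y} {h : X → Y}
    (hD : ∀ i, D i ∉ {z : X × Y | h z.1 ≠ z.2}) : empiricalRisk01 D h = 0 := by
  simp [empiricalRisk01, Set.indicator_of_notMem (hD _)]

theorem forall_notMem_of_empiricalRisk01_nonpos {X Y : Type*} {n : ℕ}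
    {D : Fin n → X × Y} {h : X → Y}
    (hD : empiricalRisk01 D h ≤ 0) (i : Fin n) : D i ∉ {z : X × Y | h z.1 ≠ z.2} := by
  intro hi
  have hn : (0 : ℝ) < (n : ℝ)⁻¹ := inv_pos.2 (Nat.cast_pos.2 i.pos)
  have hle : (1 : ℝ) ≤ ∑ j, ({z : X × Y | h z.1 ≠ z.2}).indicator (fun _ => (1 : ℝ)) (D j) := by
    have := Finset.single_le_sum
      (f := fun j => ({z : X × Y | h z.1 ≠ z.2}).indicator (fun _ => (1 : ℝ)) (D j))
      (fun j _ => Set.indicator_nonneg (fun _ _ => zero_le_one) _) (Finset.mem_univ i)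
    simpa only [Set.indicator_of_mem hi] using this
  have : 0 < empiricalRisk01 D h := mul_pos hn (by linarith)
  linarith

/-- **Exponential PAC bound for finite, realisable hypothesis classes.**
If `H` is a finite nonempty class of measurable hypotheses, realisability holds, and `ĥ` is any
empirical risk minimiser for the i.i.d. training set of size `n`, then for every `ε > 0`,
the probability over the draw of the training set that `L(ĥ) > ε` is at most `|H| · e^{-εn}`. -/
theorem pac_finite_realisable_exponential
    {n : ℕ}
    (H : Finset (X → Y)) (hH : H.Nonempty)
    (hmeas : ∀ h ∈ H, Measurable h ∧ MeasurableSet {z : X × Y | h z.1 ≠ z.2})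
    (p : Measure (X × Y)) [IsProbabilityMeasure p]
    (hrealisable : ∃ h ∈ H, expectedRisk01 p h = 0)
    (erm : (Fin n → X × Y) → X → Y)
    (herm : ∀ D : Fin n → X × Y,
      erm D ∈ H ∧ ∀ h ∈ H, empiricalRisk01 D (erm D) ≤ empiricalRisk01 D h)
    (ε : ℝ) (hε : 0 < ε) :
    ((Measure.pi fun _ : Fin n => p) {D | ε < expectedRisk01 p (erm D)}).toReal
      ≤ H.card * Real.exp (-(ε * n)) := by
  classical
  obtain ⟨g, hgH, hg⟩ := hrealisable
  have hg0 : p {z : X × Y | g z.1 ≠ z.2} = 0 :=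
    (ENNReal.toReal_eq_zero_iff _).1 hg |>.resolve_right (measure_ne_top _ _)
  let B := H.filter fun h => ε < expectedRisk01 p h
  have hsub : {D | ε < expectedRisk01 p (erm D)} ≤ᵐ[Measure.pi fun _ : Fin n => p]
      ⋃ h ∈ B, {D | ∀ i, D i ∉ {z : X × Y | h z.1 ≠ z.2}} := by
    filter_upwards [ae_pi_forall_notMem p hg0 n] with D hD hbad
    refine Set.mem_biUnion (Finset.mem_filter.2 ⟨(herm D).1, hbad⟩) ?_
    exact forall_notMem_of_empiricalRisk01_nonpos
      (((herm D).2 g hgH).trans_eq (empiricalRisk01_eq_zero_of_forall hD))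
  calc ((Measure.pi fun _ : Fin n => p) {D | ε < expectedRisk01 p (erm D)}).toReal
      ≤ (Measure.pi fun _ : Fin n => p).real
          (⋃ h ∈ B, {D | ∀ i, D i ∉ {z : X × Y | h z.1 ≠ z.2}}) :=
        ENNReal.toReal_mono (measure_ne_top _ _) (measure_mono_ae hsub)
    _ ≤ ∑ h ∈ B, (Measure.pi fun _ : Fin n => p).real
          {D | ∀ i, D i ∉ {z : X × Y | h z.1 ≠ z.2}} := measureReal_biUnion_finset_le _ _
    _ ≤ ∑ _h ∈ B, Real.exp (-(ε * n)) := by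
        refine Finset.sum_le_sum fun h hh => ?_
        obtain ⟨hhH, hεh⟩ := Finset.mem_filter.1 hh
        exact measureReal_pi_compl_le_exp p (hmeas h hhH).2 hεh.le n
    _ = B.card * Real.exp (-(ε * n)) := by rw [Finset.sum_const, nsmul_eq_mul]
    _ ≤ H.card * Real.exp (-(ε * n)) := by
        gcongr
        exact Finset.filter_subset _ _
end

section
/- Let H be a finite, nonempty class of measurable hypotheses h : X → Y, l the zero-one loss, p* a probability distribution over X × Y, and fix ε > 0. Let B = {h ∈ H : L(h) > ε} be the set of 'bad' hypotheses. Then the probability over n i.i.d. training samples from p* that there exists some h ∈ B whose empirical risk is zero satisfies P[∃ h ∈ B : L̂(h) = 0] ≤ Σ_{h ∈ B} P[L̂(h) = 0] ≤ |B| · e^{−εn} ≤ |H| · e^{−εn}. -/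
open MeasureTheory Real

variable {X Y : Type*} [MeasurableSpace X] [MeasurableSpace Y]

theorem empiricalRisk01_eq_zero_iff {X Y : Type*} {n : ℕ} (D : Fin n → X × Y) (h : X → Y) :
    empiricalRisk01 D h = 0 ↔ ∀ i, h (D i).1 = (D i).2 := by
  rcases Nat.eq_zero_or_pos n with rfl | hn
  · simp [empiricalRisk01]
  · have hn' : (n : ℝ)⁻¹ ≠ 0 := inv_ne_zero (Nat.cast_ne_zero.mpr hn.ne')
    rw [empiricalRisk01, mul_eq_zero, or_iff_right hn', Finset.sum_eq_zero_iff_of_nonneg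
      fun i _ => Set.indicator_nonneg (fun _ _ => zero_le_one) _]
    simp

/-- The empirical risk vanishes on an i.i.d. sample of size `n` with probability
`(1 - L(h)) ^ n`. -/
theorem measureReal_pi_empiricalRisk01_eq_zero (n : ℕ) (p : Measure (X × Y))
    [IsProbabilityMeasure p] {h : X → Y} (hs : MeasurableSet {z : X × Y | h z.1 ≠ z.2}) :
    (Measure.pi fun _ : Fin n => p).real {D | empiricalRisk01 D h = 0} =
      (1 - expectedRisk01 p h) ^ n := by
  have hset : {D : Fin n → X × Y | empiricalRisk01 D h = 0} =
      Set.univ.pi fun _ => {z : X × Y | h z.1 ≠ z.2}ᶜ := by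
    ext D
    simp [empiricalRisk01_eq_zero_iff]
  rw [hset, Measure.real, Measure.pi_pi, Finset.prod_const, Finset.card_univ, Fintype.card_fin,
    ENNReal.toReal_pow, ← Measure.real, probReal_compl_eq_one_sub hs]
  rfl

theorem measureReal_pi_empiricalRisk01_eq_zero_le_exp (n : ℕ) (p : Measure (X × Y))
    [IsProbabilityMeasure p] {h : X → Y} (hs : MeasurableSet {z : X × Y | h z.1 ≠ z.2})
    {ε : ℝ} (hε : ε ≤ expectedRisk01 p h) :
    (Measure.pi fun _ : Fin n => p).real {D | empiricalRisk01 D h = 0} ≤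
      Real.exp (-(ε * n)) := by
  have hle : expectedRisk01 p h ≤ 1 := measureReal_le_one
  calc (Measure.pi fun _ : Fin n => p).real {D | empiricalRisk01 D h = 0}
      = (1 - expectedRisk01 p h) ^ n := measureReal_pi_empiricalRisk01_eq_zero n p hs
    _ ≤ Real.exp (-ε) ^ n := by
        refine pow_le_pow_left₀ (sub_nonneg.mpr hle) ?_ n
        linarith [Real.add_one_le_exp (-ε)]
    _ = Real.exp (-(ε * n)) := by
        rw [← Real.exp_nat_mul]
        ring_nf

/-- **Union bound over the bad hypotheses.**
Let `B = {h ∈ H : L(h) > ε}` be the set of 'bad' hypotheses. Then the probability over the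
`n` i.i.d. training samples that some bad hypothesis has zero empirical risk satisfies
`P[∃ h ∈ B, L̂(h) = 0] ≤ ∑_{h ∈ B} P[L̂(h) = 0] ≤ |B| · e^{-εn} ≤ |H| · e^{-εn}`. -/
theorem union_bound_bad_hypotheses
    {n : ℕ}
    (H : Finset (X → Y)) (hH : H.Nonempty)
    (hmeas : ∀ h ∈ H, Measurable h ∧ MeasurableSet {z : X × Y | h z.1 ≠ z.2})
    (p : Measure (X × Y)) [IsProbabilityMeasure p]
    (ε : ℝ) (hε : 0 < ε)
    (B : Finset (X → Y)) (hB : ∀ h, h ∈ B ↔ h ∈ H ∧ ε < expectedRisk01 p h) :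
    ((Measure.pi fun _ : Fin n => p) {D | ∃ h ∈ B, empiricalRisk01 D h = 0}).toReal
        ≤ ∑ h ∈ B, ((Measure.pi fun _ : Fin n => p) {D | empiricalRisk01 D h = 0}).toReal ∧
      (∑ h ∈ B, ((Measure.pi fun _ : Fin n => p) {D | empiricalRisk01 D h = 0}).toReal)
        ≤ B.card * Real.exp (-(ε * n)) ∧
      (B.card : ℝ) * Real.exp (-(ε * n)) ≤ H.card * Real.exp (-(ε * n)) := by
  refine ⟨?_, ?_, ?_⟩
  · have hset : {D : Fin n → X × Y | ∃ h ∈ B, empiricalRisk01 D h = 0} =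
        ⋃ h ∈ B, {D | empiricalRisk01 D h = 0} := by
      ext D
      simp
    rw [hset]
    exact measureReal_biUnion_finset_le B _
  · rw [← nsmul_eq_mul]
    refine Finset.sum_le_card_nsmul B _ _ fun h hh => ?_
    obtain ⟨hH', hlt⟩ := (hB h).mp hh
    exact measureReal_pi_empiricalRisk01_eq_zero_le_exp n p (hmeas h hH').2 hlt.le
  · have hsub : B ⊆ H := fun h hh => ((hB h).mp hh).1
    gcongr
end

section
/- Let H be a finite, nonempty class of measurable hypotheses h : X → Y, l a loss function with values in [0,1] (e.g., the zero-one loss), and p* a probability distribution over X × Y from which n i.i.d. training samples are drawn. Let h* be an expected risk minimiser and ĥ an empirical risk minimiser over H. Then for every δ ∈ (0,1), with probability at least 1 − δ over the draw of the training set, L(ĥ) − L(h*) ≤ √(2(log|H| + log(2/δ))/n). -/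
open MeasureTheory Real

variable {X Y : Type*} [MeasurableSpace X] [MeasurableSpace Y]

/-- Expected risk of a hypothesis `h : X → Y` for a loss `l` and a data distribution `p`
on `X × Y`: `L(h) = E_{z ∼ p}[l(z, h)]`. -/
noncomputable def expRisk (p : Measure (X × Y)) (l : X × Y → (X → Y) → ℝ) (h : X → Y) : ℝ :=
  ∫ z, l z h ∂p

/-- Empirical risk of a hypothesis `h : X → Y` for a loss `l` on a training set
`D = (z₁,…,zₙ)`: `L̂(h) = (1/n) ∑ᵢ l(zᵢ, h)`. -/
noncomputable def empRisk {n : ℕ} (l : X × Y → (X → Y) → ℝ) (D : Fin n → X × Y)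
    (h : X → Y) : ℝ :=
  (n : ℝ)⁻¹ * ∑ i, l (D i) h

open ProbabilityTheory in
/-- Chernoff bound for a sum of i.i.d. sub-Gaussian variables on a product space. -/
theorem measureReal_pi_sum_ge_le {Z : Type*} [MeasurableSpace Z] {n : ℕ} (p : Measure Z)
    [IsProbabilityMeasure p] {f : Z → ℝ} {c : NNReal} (hf : HasSubgaussianMGF f c p)
    {s : ℝ} (hs : 0 ≤ s) :
    (Measure.pi fun _ : Fin n => p).real {D | s ≤ ∑ i, f (D i)}
      ≤ exp (-s ^ 2 / (2 * (n * c))) := by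
  have hindep : iIndepFun (fun (i : Fin n) (D : Fin n → Z) => f (D i))
      (Measure.pi fun _ : Fin n => p) := iIndepFun_pi fun _ => hf.aemeasurable
  have hsub (i : Fin n) :
      HasSubgaussianMGF (fun D : Fin n → Z => f (D i)) c (Measure.pi fun _ : Fin n => p) := by
    have he := measurePreserving_eval (fun _ : Fin n => p) i
    refine HasSubgaussianMGF.of_map (X := f) he.measurable.aemeasurable ?_
    rwa [he.map_eq]
  simpa using HasSubgaussianMGF.measure_sum_ge_le_of_iIndepFun hindep (c := fun _ => c)
    (s := Finset.univ) (fun i _ => hsub i) hs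

open ProbabilityTheory in
/-- Two-sided Hoeffding inequality for the empirical mean of a `[0,1]`-valued function. -/
theorem measureReal_pi_abs_mean_sub_integral_ge_le {Z : Type*} [MeasurableSpace Z] {n : ℕ}
    (hn : 0 < n) (p : Measure Z) [IsProbabilityMeasure p] {f : Z → ℝ} (hf : Measurable f)
    (hf01 : ∀ z, f z ∈ Set.Icc (0 : ℝ) 1) {t : ℝ} (ht : 0 ≤ t) :
    (Measure.pi fun _ : Fin n => p).real
        {D | t ≤ |(n : ℝ)⁻¹ * ∑ i, f (D i) - ∫ z, f z ∂p|}
      ≤ 2 * exp (-2 * n * t ^ 2) := by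
  have hn' : (0 : ℝ) < n := by exact_mod_cast hn
  have hsub := hasSubgaussianMGF_of_mem_Icc (μ := p) hf.aemeasurable (ae_of_all _ hf01)
  have hup := measureReal_pi_sum_ge_le (n := n) p hsub (mul_nonneg hn'.le ht)
  have hlow := measureReal_pi_sum_ge_le (n := n) p hsub.neg (mul_nonneg hn'.le ht)
  have hexp : -(n * t) ^ 2 / (2 * (n * (((‖(1 : ℝ) - 0‖₊ / 2) ^ 2 : NNReal) : ℝ)))
      = -2 * n * t ^ 2 := by
    simp only [sub_zero, nnnorm_one, NNReal.coe_pow, NNReal.coe_div, NNReal.coe_one,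
      NNReal.coe_ofNat]
    field_simp
  rw [hexp] at hup hlow
  calc _ ≤ _ := measureReal_mono (fun D hD => ?_)
    _ ≤ _ := measureReal_union_le _ _
    _ ≤ _ := add_le_add hup hlow
    _ = _ := (two_mul _).symm
  have hmean : n * ((n : ℝ)⁻¹ * ∑ i, f (D i) - ∫ z, f z ∂p)
      = ∑ i, (f (D i) - ∫ z, f z ∂p) := by
    simp [mul_sub, hn'.ne']
  rcases le_abs.1 (Set.mem_ofPred_eq ▸ hD) with h | h
  · left
    exact (mul_le_mul_of_nonneg_left h hn'.le).trans_eq hmean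
  · right
    refine (mul_le_mul_of_nonneg_left h hn'.le).trans_eq ?_
    rw [mul_neg, hmean]
    simp only [Pi.neg_apply, Finset.sum_neg_distrib]

/-- **PAC bound for finite hypothesis classes without realisability.**
For a finite nonempty class `H` of measurable hypotheses and a `[0,1]`-valued loss, with `h*`
an expected risk minimiser and `ĥ` an empirical risk minimiser over `H`, for every
`δ ∈ (0,1)`, with probability at least `1 - δ` over the `n` i.i.d. training samples,
`L(ĥ) - L(h*) ≤ √(2 (log |H| + log (2/δ)) / n)`. -/
theorem pac_finite_agnostic
    {n : ℕ} (hn : 0 < n)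
    (H : Finset (X → Y)) (hH : H.Nonempty)
    (l : X × Y → (X → Y) → ℝ) (hl : ∀ z h, l z h ∈ Set.Icc (0 : ℝ) 1)
    (hmeas : ∀ h ∈ H, Measurable fun z => l z h)
    (p : Measure (X × Y)) [IsProbabilityMeasure p]
    (hstar : X → Y) (hstarmem : hstar ∈ H)
    (hstaropt : ∀ h ∈ H, expRisk p l hstar ≤ expRisk p l h)
    (erm : (Fin n → X × Y) → X → Y)
    (herm : ∀ D : Fin n → X × Y,
      erm D ∈ H ∧ ∀ h ∈ H, empRisk l D (erm D) ≤ empRisk l D h)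
    (δ : ℝ) (hδ : δ ∈ Set.Ioo (0 : ℝ) 1) :
    1 - δ ≤
      ((Measure.pi fun _ : Fin n => p)
        {D | expRisk p l (erm D) - expRisk p l hstar
          ≤ Real.sqrt (2 * (Real.log H.card + Real.log (2 / δ)) / n)}).toReal := by
  classical
  obtain ⟨hδ0, hδ1⟩ := hδ
  have hn' : (0 : ℝ) < n := by exact_mod_cast hn
  have hcard : (1 : ℝ) ≤ H.card := by exact_mod_cast hH.card_pos
  set P := Measure.pi fun _ : Fin n => p
  set a := Real.log H.card + Real.log (2 / δ) with ha
  have ha0 : 0 ≤ a := add_nonneg (Real.log_nonneg hcard)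
    (Real.log_nonneg (by rw [le_div_iff₀ hδ0]; linarith))
  set ε := Real.sqrt (2 * a / n) with hε
  have hε2 : ε ^ 2 = 2 * a / n := Real.sq_sqrt (by positivity)
  let bad (h : X → Y) : Set (Fin n → X × Y) := {D | ε / 2 ≤ |empRisk l D h - expRisk p l h|}
  have hexp : exp (-2 * n * (ε / 2) ^ 2) = δ / (2 * H.card) := by
    have : -2 * n * (ε / 2) ^ 2 = -a := by
      rw [div_pow, hε2]
      field_simp
    rw [this, Real.exp_neg, ha, Real.exp_add, Real.exp_log (by positivity),
      Real.exp_log (by positivity)]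
    field_simp
  have hbad : P.real (⋃ h ∈ H, bad h) ≤ δ := by
    calc _ ≤ ∑ h ∈ H, P.real (bad h) := measureReal_biUnion_finset_le _ _
      _ ≤ ∑ _h ∈ H, 2 * (δ / (2 * H.card)) := by
        refine Finset.sum_le_sum fun h hh => ?_
        rw [← hexp]
        exact measureReal_pi_abs_mean_sub_integral_ge_le hn p (hmeas h hh) (fun z => hl z h)
          (by positivity)
      _ = δ := by
        rw [Finset.sum_const, nsmul_eq_mul]
        field_simp
  set good := {D | expRisk p l (erm D) - expRisk p l hstar ≤ ε}
  have hcover : Set.univ ⊆ good ∪ ⋃ h ∈ H, bad h := by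
    refine fun D _ => or_iff_not_imp_right.2 fun hD => ?_
    simp only [Set.mem_iUnion, not_exists] at hD
    have hdev (h : X → Y) (hh : h ∈ H) : |empRisk l D h - expRisk p l h| < ε / 2 :=
      not_le.1 (hD h hh)
    have h₁ := abs_lt.1 (hdev _ (herm D).1)
    have h₂ := abs_lt.1 (hdev _ hstarmem)
    have h₃ := (herm D).2 _ hstarmem
    change expRisk p l (erm D) - expRisk p l hstar ≤ ε
    linarith
  have htotal : 1 ≤ P.real good + P.real (⋃ h ∈ H, bad h) := by
    rw [← probReal_univ (μ := P)]
    exact (measureReal_mono hcover).trans (measureReal_union_le _ _)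
  change 1 - δ ≤ P.real good
  linarith
end

section
/- Let H be a nonempty class of measurable hypotheses, l a loss function with values in [0,1], and p* a probability distribution over X × Y from which n i.i.d. training samples Z_1,…,Z_n are drawn. Define G_n = sup_{h ∈ H} (L(h) − L̂(h)), where L(h) is the expected risk and L̂(h) the empirical risk on the training set (assume G_n is measurable and integrable, e.g. when H is countable). Then for every ε > 0, the tail bound P[G_n ≥ E[G_n] + ε] ≤ exp(−2nε²) holds. -/
open MeasureTheory Real

variable {X Y : Type*} [MeasurableSpace X] [MeasurableSpace Y]

open ProbabilityTheory
open scoped NNReal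

section BoundedDifferences

variable {α : Type*} {n : ℕ}

theorem abs_sub_le_of_bounded_differences {f : (Fin n → α) → ℝ} {c : Fin n → ℝ≥0}
    (hf : ∀ x i z, |f (Function.update x i z) - f x| ≤ c i) (x y : Fin n → α) :
    |f x - f y| ≤ ∑ i, (c i : ℝ) := by
  induction n with
  | zero => simp [Subsingleton.elim x y]
  | succ n ih =>
    have hhead : |f x - f (Fin.cons (y 0) (Fin.tail x))| ≤ c 0 := by
      rw [abs_sub_comm]
      simpa [← Fin.update_cons_zero (x 0) (Fin.tail x) (y 0)] using hf x 0 (y 0)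
    have htail := ih (f := fun v => f (Fin.cons (y 0) v)) (c := fun i => c i.succ)
      (fun v i z => by simpa only [Fin.cons_update] using hf (Fin.cons (y 0) v) i.succ z)
      (Fin.tail x) (Fin.tail y)
    rw [Fin.cons_self_tail] at htail
    rw [Fin.sum_univ_succ]
    exact (abs_sub_le _ _ _).trans (add_le_add hhead htail)

variable [MeasurableSpace α]

theorem hasSubgaussianMGF_of_abs_sub_le {μ : Measure α} [IsProbabilityMeasure μ] {f : α → ℝ}
    {c : ℝ≥0} (hm : Measurable f) (hf : ∀ x y, |f x - f y| ≤ c) :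
    HasSubgaussianMGF (fun x => f x - ∫ y, f y ∂μ) ((c / 2) ^ 2) μ := by
  have : Nonempty α := nonempty_of_isProbabilityMeasure μ
  have hbdd : BddBelow (Set.range f) := by
    obtain ⟨x₀⟩ := this
    refine ⟨f x₀ - c, ?_⟩
    rintro _ ⟨x, rfl⟩
    linarith [(abs_le.mp (hf x x₀)).1]
  have h := hasSubgaussianMGF_of_mem_Icc (μ := μ) (X := f) (a := ⨅ x, f x)
    (b := (⨅ x, f x) + c) hm.aemeasurable <| .of_forall fun x => by
      refine ⟨ciInf_le hbdd x, ?_⟩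
      have : f x - c ≤ ⨅ y, f y := le_ciInf fun y => by linarith [(abs_le.mp (hf x y)).2]
      linarith
  simpa using h

theorem hasSubgaussianMGF_prod {β : Type*} [MeasurableSpace β] {μ : Measure α} {ν : Measure β}
    [IsProbabilityMeasure μ] [IsProbabilityMeasure ν] {f : α × β → ℝ} {a b : ℝ≥0} {C : ℝ}
    (hm : Measurable f) (hC : ∀ z, |f z| ≤ C)
    (ha : ∀ y, HasSubgaussianMGF (fun x => f (x, y) - ∫ x', f (x', y) ∂μ) a μ)
    (hb : HasSubgaussianMGF (fun y => ∫ x, f (x, y) ∂μ - ∫ y', ∫ x, f (x, y') ∂μ ∂ν) b ν) :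
    HasSubgaussianMGF (fun z => f z - ∫ z', f z' ∂(μ.prod ν)) (a + b) (μ.prod ν) := by
  have hint : Integrable f (μ.prod ν) :=
    .of_bound hm.aestronglyMeasurable C (.of_forall hC)
  have hexp (t : ℝ) :
      Integrable (fun z => exp (t * (f z - ∫ z', f z' ∂(μ.prod ν)))) (μ.prod ν) :=
    integrable_exp_mul_of_mem_Icc (a := -C - ∫ z', f z' ∂(μ.prod ν))
      (b := C - ∫ z', f z' ∂(μ.prod ν)) (hm.sub_const _).aemeasurable <|
      .of_forall fun z => ⟨sub_le_sub_right (abs_le.mp (hC z)).1 _,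
        sub_le_sub_right (abs_le.mp (hC z)).2 _⟩
  refine ⟨hexp, fun t => ?_⟩
  set g : β → ℝ := fun y => ∫ x, f (x, y) ∂μ
  have hmean : ∫ z, f z ∂(μ.prod ν) = ∫ y, g y ∂ν := integral_prod_symm f hint
  calc mgf (fun z => f z - ∫ z', f z' ∂(μ.prod ν)) (μ.prod ν) t
      = ∫ y, ∫ x, exp (t * (f (x, y) - ∫ z', f z' ∂(μ.prod ν))) ∂μ ∂ν :=
        integral_prod_symm _ (hexp t)
    _ ≤ ∫ y, exp (a * t ^ 2 / 2) * exp (t * (g y - ∫ y', g y' ∂ν)) ∂ν := by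
        refine integral_mono (hexp t).integral_prod_right
          ((hb.integrable_exp_mul t).const_mul _) fun y => ?_
        have hsplit (x : α) : exp (t * (f (x, y) - ∫ z', f z' ∂(μ.prod ν)))
            = exp (t * (f (x, y) - g y)) * exp (t * (g y - ∫ y', g y' ∂ν)) := by
          rw [← exp_add, hmean]
          ring_nf
        simp only [hsplit, integral_mul_const]
        gcongr
        exact (ha y).mgf_le t
    _ ≤ exp (a * t ^ 2 / 2) * exp (b * t ^ 2 / 2) := by
        rw [integral_const_mul]
        gcongr
        exact hb.mgf_le t
    _ = exp ((a + b : ℝ≥0) * t ^ 2 / 2) := by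
        rw [← exp_add, NNReal.coe_add]
        ring_nf

/-- A function with bounded differences of independent variables is sub-Gaussian around
its mean. -/
theorem hasSubgaussianMGF_of_bounded_differences (μ : Fin n → Measure α)
    [∀ i, IsProbabilityMeasure (μ i)] {f : (Fin n → α) → ℝ} {c : Fin n → ℝ≥0}
    (hm : Measurable f) (hf : ∀ x i z, |f (Function.update x i z) - f x| ≤ c i) :
    HasSubgaussianMGF (fun x => f x - ∫ y, f y ∂(Measure.pi μ)) (∑ i, (c i / 2) ^ 2)
      (Measure.pi μ) := by
  induction n with
  | zero =>
    have hconst : (fun x => f x - ∫ y, f y ∂(Measure.pi μ)) = fun _ => 0 := by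
      funext x
      have : f = fun _ => f x := funext fun y => congrArg f (Subsingleton.elim y x)
      rw [this]
      simp
    rw [hconst]
    simp
  | succ n ih =>
    have hcons : Measurable fun z : α × (Fin n → α) => (Fin.cons z.1 z.2 : Fin (n + 1) → α) := by
      simpa [MeasurableEquiv.piFinSuccAbove, Fin.insertNthEquiv, Fin.insertNth_zero'] using
        (MeasurableEquiv.piFinSuccAbove (fun _ : Fin (n + 1) => α) 0).symm.measurable
    have hpres : MeasurePreserving
        (fun x : Fin (n + 1) → α => (x 0, Fin.tail x)) (Measure.pi μ)
        ((μ 0).prod (Measure.pi fun i => μ i.succ)) :=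
      measurePreserving_piFinSuccAbove μ 0
    set F : α × (Fin n → α) → ℝ := fun z => f (Fin.cons z.1 z.2)
    have hF : Measurable F := hm.comp hcons
    obtain ⟨C, hC⟩ : ∃ C, ∀ z, |F z| ≤ C := by
      have : Nonempty α := nonempty_of_isProbabilityMeasure (μ 0)
      obtain ⟨x₀⟩ := this
      refine ⟨∑ i, (c i : ℝ) + |f fun _ => x₀|, fun z => ?_⟩
      have h := abs_sub_le_of_bounded_differences hf (Fin.cons z.1 z.2) fun _ => x₀
      linarith [abs_sub_abs_le_abs_sub (F z) (f fun _ => x₀)]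
    have hslice (y : Fin n → α) : Integrable (fun x => F (x, y)) (μ 0) :=
      .of_bound (hF.comp measurable_prodMk_right).aestronglyMeasurable C
        (.of_forall fun x => hC (x, y))
    have hprod := hasSubgaussianMGF_prod (μ := μ 0) (ν := Measure.pi fun i => μ i.succ)
      (a := (c 0 / 2) ^ 2) (b := ∑ i : Fin n, (c i.succ / 2) ^ 2) hF hC
      (fun y => hasSubgaussianMGF_of_abs_sub_le (hF.comp measurable_prodMk_right) fun x x' => by
        simpa only [F, Fin.update_cons_zero] using hf (Fin.cons x' y) 0 x)
      (ih _ hF.stronglyMeasurable.integral_prod_left'.measurable fun y i z => by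
        rw [← integral_sub (hslice _) (hslice _)]
        have hbound (x : α) : ‖F (x, Function.update y i z) - F (x, y)‖ ≤ c i.succ := by
          simpa only [F, Fin.cons_update, Real.norm_eq_abs] using hf (Fin.cons x y) i.succ z
        simpa using norm_integral_le_of_norm_le_const (μ := μ 0) (.of_forall hbound))
    rw [Fin.sum_univ_succ]
    have hcomp (x : Fin (n + 1) → α) : F (x 0, Fin.tail x) = f x := by
      simp [F, Fin.cons_self_tail]
    have hmean : ∫ z, F z ∂((μ 0).prod (Measure.pi fun i => μ i.succ))
        = ∫ x, f x ∂(Measure.pi μ) := by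
      rw [← hpres.map_eq, integral_map hpres.measurable.aemeasurable hF.aestronglyMeasurable]
      simp only [hcomp]
    rw [hmean, ← hpres.map_eq] at hprod
    have h := hprod.of_map hpres.measurable.aemeasurable
    simpa only [Function.comp_def, hcomp] using h

end BoundedDifferences

theorem expRisk_mem_Icc {p : Measure (X × Y)} [IsProbabilityMeasure p]
    {l : X × Y → (X → Y) → ℝ} (hl : ∀ z h, l z h ∈ Set.Icc (0 : ℝ) 1) (h : X → Y) :
    expRisk p l h ∈ Set.Icc (0 : ℝ) 1 := by
  refine ⟨integral_nonneg fun z => (hl z h).1, ?_⟩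
  have := norm_integral_le_of_norm_le_const (μ := p) (f := fun z => l z h) (C := 1)
    (.of_forall fun z => by simpa [abs_of_nonneg (hl z h).1] using (hl z h).2)
  simpa [expRisk] using (le_abs_self _).trans this

theorem empRisk_nonneg {X Y : Type*} {n : ℕ} {l : X × Y → (X → Y) → ℝ}
    (hl : ∀ z h, l z h ∈ Set.Icc (0 : ℝ) 1) (D : Fin n → X × Y) (h : X → Y) :
    0 ≤ empRisk l D h :=
  mul_nonneg (by positivity) (Finset.sum_nonneg fun i _ => (hl (D i) h).1)

theorem empRisk_update_sub_le {X Y : Type*} {n : ℕ} {l : X × Y → (X → Y) → ℝ}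
    (hl : ∀ z h, l z h ∈ Set.Icc (0 : ℝ) 1) (D : Fin n → X × Y) (i : Fin n) (z : X × Y)
    (h : X → Y) :
    |empRisk l (Function.update D i z) h - empRisk l D h| ≤ (n : ℝ)⁻¹ := by
  have hsum : ∑ j, l (Function.update D i z j) h - ∑ j, l (D j) h = l z h - l (D i) h := by
    rw [← Finset.sum_sub_distrib, Finset.sum_eq_single i]
    · simp
    · intro j _ hj
      simp [Function.update_of_ne hj]
    · simp
  rw [empRisk, empRisk, ← mul_sub, hsum, abs_mul, abs_of_nonneg (by positivity)]
  refine mul_le_of_le_one_right (by positivity) (abs_le.mpr ⟨?_, ?_⟩) <;>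
    linarith [(hl z h).1, (hl z h).2, (hl (D i) h).1, (hl (D i) h).2]

theorem abs_ciSup_sub_ciSup_le {ι : Type*} [Nonempty ι] {u v : ι → ℝ} {c : ℝ}
    (hu : BddAbove (Set.range u)) (hv : BddAbove (Set.range v)) (huv : ∀ i, |u i - v i| ≤ c) :
    |(⨆ i, u i) - ⨆ i, v i| ≤ c := by
  have h₁ : ⨆ i, u i ≤ (⨆ i, v i) + c := ciSup_le fun i => by
    linarith [(abs_le.mp (huv i)).2, le_ciSup hv i]
  have h₂ : ⨆ i, v i ≤ (⨆ i, u i) + c := ciSup_le fun i => by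
    linarith [(abs_le.mp (huv i)).1, le_ciSup hu i]
  exact abs_le.mpr ⟨by linarith, by linarith⟩

/-- **McDiarmid tail bound for the uniform deviation `G_n`.**
For a `[0,1]`-valued loss and `G_n(D) = sup_{h ∈ H} (L(h) - L̂(h))`, assumed measurable and
integrable as a function of the training set of `n` i.i.d. samples, for every `ε > 0`,
`P[G_n ≥ E[G_n] + ε] ≤ exp (-2 n ε²)`. -/
theorem mcdiarmid_tail_bound_gn
    {n : ℕ}
    (H : Set (X → Y)) (hH : H.Nonempty)
    (l : X × Y → (X → Y) → ℝ) (hl : ∀ z h, l z h ∈ Set.Icc (0 : ℝ) 1)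
    (hmeas : ∀ h ∈ H, Measurable fun z => l z h)
    (p : Measure (X × Y)) [IsProbabilityMeasure p]
    (G : (Fin n → X × Y) → ℝ)
    (hG : ∀ D, G D = ⨆ h : H, (expRisk p l h.1 - empRisk l D h.1))
    (hGmeas : Measurable G)
    (hGint : Integrable G (Measure.pi fun _ : Fin n => p))
    (ε : ℝ) (hε : 0 < ε) :
    ((Measure.pi fun _ : Fin n => p)
        {D | (∫ D', G D' ∂(Measure.pi fun _ : Fin n => p)) + ε ≤ G D}).toReal
      ≤ Real.exp (-(2 * n * ε ^ 2)) := by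
  have : Nonempty H := hH.to_subtype
  have hbdd (D : Fin n → X × Y) :
      BddAbove (Set.range fun h : H => expRisk p l h.1 - empRisk l D h.1) := by
    refine ⟨1, ?_⟩
    rintro _ ⟨h, rfl⟩
    linarith [(expRisk_mem_Icc (p := p) hl h.1).2, empRisk_nonneg hl D h.1]
  have hdiff (D : Fin n → X × Y) (i : Fin n) (z : X × Y) :
      |G (Function.update D i z) - G D| ≤ ((n : ℝ≥0)⁻¹ : ℝ≥0) := by
    rw [hG, hG]
    refine abs_ciSup_sub_ciSup_le (hbdd _) (hbdd _) fun h => ?_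
    rw [sub_sub_sub_cancel_left, abs_sub_comm]
    simpa using empRisk_update_sub_le hl D i z h.1
  have htail :=
    (hasSubgaussianMGF_of_bounded_differences (fun _ : Fin n => p) hGmeas hdiff).measure_ge_le
      hε.le
  simp only [le_sub_iff_add_le'] at htail
  refine htail.trans_eq (congrArg Real.exp ?_)
  rcases eq_or_ne n 0 with rfl | hn
  · simp
  · simp
    field_simp
end

section
/- Let H be a countable, nonempty class of measurable hypotheses, l a loss function with values in [0,1], and p* a probability distribution over X × Y from which n i.i.d. training samples are drawn. Let h* be an expected risk minimiser and ĥ an empirical risk minimiser over H. Then for every δ ∈ (0,1), with probability at least 1 − δ over the draw of the training set, L(ĥ) − L(h*) ≤ 4 R_n(A) + √(2 log(2/δ)/n), where A = {z ↦ l(z,h) : h ∈ H} is the loss class and R_n(A) its Rademacher complexity. -/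
open MeasureTheory Real

variable {X Y : Type*} [MeasurableSpace X] [MeasurableSpace Y]

/-- Rademacher complexity of a class `A` of real-valued functions on `X × Y`, for sample size
`n` and data distribution `p`:
`R_n(A) = E[sup_{f ∈ A} (1/n) ∑ᵢ σᵢ f(Zᵢ)]`, where `Z₁,…,Zₙ` are i.i.d. from `p` and
`σ₁,…,σₙ` are independent Rademacher variables (uniform on `{-1,+1}`, encoded by independent
uniform Booleans) independent of the `Zᵢ`. -/
noncomputable def rademacherComplexity (n : ℕ) (p : Measure (X × Y))
    (A : Set (X × Y → ℝ)) : ℝ :=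
  ∫ D : Fin n → X × Y,
    ∫ σ : Fin n → Bool,
      ⨆ f : A, (n : ℝ)⁻¹ * ∑ i, (if σ i then (1 : ℝ) else -1) * f.1 (D i)
      ∂(Measure.pi fun _ : Fin n => (PMF.uniformOfFintype Bool).toMeasure)
    ∂(Measure.pi fun _ : Fin n => p)

section BoundedDifferences

open ProbabilityTheory
open scoped NNReal

lemma Measurable.integrable_of_abs_le {Ω : Type*} [MeasurableSpace Ω] {μ : Measure Ω}
    [IsFiniteMeasure μ] {f : Ω → ℝ} (hf : Measurable f) {B : ℝ} (hB : ∀ ω, |f ω| ≤ B) :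
    Integrable f μ :=
  .of_bound hf.aestronglyMeasurable B (.of_forall hB)

/-- A bounded measurable function with oscillation at most `c` is sub-Gaussian. -/
lemma hasSubgaussianMGF_of_forall_le_add {Ω : Type*} [MeasurableSpace Ω] {μ : Measure Ω}
    [IsProbabilityMeasure μ] {f : Ω → ℝ} (hf : Measurable f) {B : ℝ} (hB : ∀ ω, |f ω| ≤ B)
    {c : ℝ≥0} (hc : ∀ ω ω', f ω ≤ f ω' + c) :
    HasSubgaussianMGF (fun ω ↦ f ω - ∫ x, f x ∂μ) ((c / 2) ^ 2) μ := by
  have : Nonempty Ω := nonempty_of_isProbabilityMeasure μ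
  have hbdd : BddBelow (Set.range f) :=
    ⟨-B, by rintro _ ⟨ω, rfl⟩; exact neg_le_of_abs_le (hB ω)⟩
  have h := hasSubgaussianMGF_of_mem_Icc (μ := μ) (X := f) (a := ⨅ ω, f ω)
    (b := (⨅ ω, f ω) + c) hf.aemeasurable (.of_forall fun ω ↦ ⟨ciInf_le hbdd ω, by
      rw [← sub_le_iff_le_add]
      exact le_ciInf fun ω' ↦ by linarith [hc ω ω']⟩)
  simpa using h

/-- **McDiarmid's inequality** in sub-Gaussian form, for bounded measurable functions of i.i.d.
variables. -/
lemma hasSubgaussianMGF_of_bounded_differences_s15 {Z : Type*} [MeasurableSpace Z] (μ : Measure Z)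
    [IsProbabilityMeasure μ] {n : ℕ} {g : (Fin n → Z) → ℝ} (hg : Measurable g) {B : ℝ}
    (hB : ∀ D, |g D| ≤ B) {c : Fin n → ℝ≥0}
    (hc : ∀ D i z, g (Function.update D i z) ≤ g D + c i) :
    HasSubgaussianMGF (fun D ↦ g D - ∫ D', g D' ∂(Measure.pi fun _ ↦ μ))
      (∑ i, (c i / 2) ^ 2) (Measure.pi fun _ ↦ μ) := by
  induction n with
  | zero =>
    have : (fun D ↦ g D - ∫ D', g D' ∂(Measure.pi fun _ ↦ μ)) = fun _ ↦ 0 := by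
      ext D
      simp [integral_unique, Subsingleton.elim D default]
    rw [this]
    simp
  | succ n ih =>
    set P : Measure (Fin n → Z) := Measure.pi fun _ ↦ μ
    have hcons : Measurable fun q : Z × (Fin n → Z) ↦ (Fin.cons q.1 q.2 : Fin (n + 1) → Z) := by
      refine measurable_pi_iff.2 fun i ↦ ?_
      cases i using Fin.cases <;> simp <;> fun_prop
    have hmp : MeasurePreserving (fun q : Z × (Fin n → Z) ↦ (Fin.cons q.1 q.2 : Fin (n + 1) → Z))
        (μ.prod P) (Measure.pi fun _ ↦ μ) := by
      have h := (measurePreserving_piFinSuccAbove (fun _ : Fin (n + 1) ↦ μ) 0).symm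
      convert h using 1
      ext q i
      cases i using Fin.cases <;> simp [MeasurableEquiv.piFinSuccAbove]
    have hgc : Measurable fun q : Z × (Fin n → Z) ↦ g (Fin.cons q.1 q.2) := hg.comp hcons
    have hgz (z : Z) : Measurable fun D : Fin n → Z ↦ g (Fin.cons z D) :=
      hgc.comp measurable_prodMk_left
    have integral_eq {F : (Fin (n + 1) → Z) → ℝ} (hF : Measurable F) {C : ℝ}
        (hC : ∀ D, |F D| ≤ C) :
        ∫ D, F D ∂(Measure.pi fun _ ↦ μ) = ∫ z, ∫ D, F (Fin.cons z D) ∂P ∂μ := by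
      rw [← hmp.map_eq, integral_map hcons.aemeasurable hF.aestronglyMeasurable,
        integral_prod (fun q : Z × (Fin n → Z) ↦ F (Fin.cons q.1 q.2))
          ((hF.comp hcons).integrable_of_abs_le fun q ↦ hC _)]
    set m : Z → ℝ := fun z ↦ ∫ D, g (Fin.cons z D) ∂P with hm_def
    have hm : Measurable m := hgc.stronglyMeasurable.integral_prod_right.measurable
    have hmB (z : Z) : |m z| ≤ B := by
      simpa using norm_integral_le_of_norm_le_const (μ := P) (C := B)
        (f := fun D ↦ g (Fin.cons z D)) (.of_forall fun D ↦ hB _)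
    have hmc (z z' : Z) : m z ≤ m z' + c 0 := by
      have h : m z ≤ ∫ D, (g (Fin.cons z' D) + c 0) ∂P := by
        refine integral_mono ((hgz z).integrable_of_abs_le fun D ↦ hB _)
          (((hgz z').integrable_of_abs_le fun D ↦ hB _).add (integrable_const _)) fun D ↦ ?_
        simpa using hc (Fin.cons z' D) 0 z
      rwa [integral_add ((hgz z').integrable_of_abs_le fun D ↦ hB _) (integrable_const _),
        integral_const, probReal_univ, one_smul] at h
    have hE : ∫ D, g D ∂(Measure.pi fun _ ↦ μ) = ∫ z, m z ∂μ := integral_eq hg hB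
    rw [hE]
    set E := ∫ z, m z ∂μ
    have hsub := hasSubgaussianMGF_of_forall_le_add (μ := μ) hm hmB hmc
    have hexp_le (t : ℝ) (D) : |exp (t * (g D - E))| ≤ exp (|t| * (B + |E|)) := by
      rw [abs_of_pos (exp_pos _), exp_le_exp]
      calc t * (g D - E) ≤ |t * (g D - E)| := le_abs_self _
        _ = |t| * |g D - E| := abs_mul _ _
        _ ≤ |t| * (B + |E|) := by gcongr; exact (abs_sub _ _).trans (by gcongr; exact hB D)
    have hexp_meas (t : ℝ) : Measurable fun D ↦ exp (t * (g D - E)) := by fun_prop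
    refine ⟨fun t ↦ (hexp_meas t).integrable_of_abs_le (hexp_le t), fun t ↦ ?_⟩
    rw [mgf, integral_eq (hexp_meas t) (hexp_le t)]
    have hinner (z : Z) : ∫ D, exp (t * (g (Fin.cons z D) - E)) ∂P
        ≤ exp (t * (m z - E)) * exp ((∑ i : Fin n, (c i.succ / 2) ^ 2 : ℝ≥0) * t ^ 2 / 2) := by
      have h := (ih (hgz z) (fun D ↦ hB _) (c := fun i ↦ c i.succ) fun D i w ↦ by
        rw [Fin.cons_update]; exact hc _ _ _).mgf_le t
      calc ∫ D, exp (t * (g (Fin.cons z D) - E)) ∂P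
          = exp (t * (m z - E)) * ∫ D, exp (t * (g (Fin.cons z D) - m z)) ∂P := by
            rw [← integral_const_mul]
            congr with D
            rw [← exp_add]
            ring_nf
        _ ≤ _ := by gcongr; exact h
    calc ∫ z, ∫ D, exp (t * (g (Fin.cons z D) - E)) ∂P ∂μ
        ≤ ∫ z, exp (t * (m z - E))
            * exp ((∑ i : Fin n, (c i.succ / 2) ^ 2 : ℝ≥0) * t ^ 2 / 2) ∂μ :=
          integral_mono
            (((hexp_meas t).comp hcons).integrable_of_abs_le
              fun q ↦ hexp_le t _ : Integrable _ (μ.prod P)).integral_prod_left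
            ((hsub.integrable_exp_mul t).mul_const _) hinner
      _ = mgf (fun z ↦ m z - E) μ t
            * exp ((∑ i : Fin n, (c i.succ / 2) ^ 2 : ℝ≥0) * t ^ 2 / 2) := integral_mul_const _ _
      _ ≤ exp (((c 0 / 2) ^ 2 : ℝ≥0) * t ^ 2 / 2)
            * exp ((∑ i : Fin n, (c i.succ / 2) ^ 2 : ℝ≥0) * t ^ 2 / 2) := by
          gcongr; exact hsub.mgf_le t
      _ = _ := by
          rw [← exp_add, Fin.sum_univ_succ, NNReal.coe_add]
          ring_nf

end BoundedDifferences

section Symmetrization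

lemma abs_mean_le {n : ℕ} {a : Fin n → ℝ} {C : ℝ} (hC : 0 ≤ C) (ha : ∀ i, |a i| ≤ C) :
    |(n : ℝ)⁻¹ * ∑ i, a i| ≤ C := by
  rcases n.eq_zero_or_pos with rfl | hn
  · simpa
  have hn' : (0 : ℝ) < n := by exact_mod_cast hn
  rw [abs_mul, abs_of_pos (inv_pos.2 hn'), inv_mul_le_iff₀ hn']
  calc |∑ i, a i| ≤ ∑ i, |a i| := Finset.abs_sum_le_sum_abs _ _
    _ ≤ ∑ _i : Fin n, C := Finset.sum_le_sum fun i _ ↦ ha i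
    _ = n * C := by simp

lemma bddAbove_range_of_abs_le {ι : Type*} {a : ι → ℝ} {C : ℝ} (ha : ∀ j, |a j| ≤ C) :
    BddAbove (Set.range a) :=
  ⟨C, by rintro _ ⟨j, rfl⟩; exact le_of_abs_le (ha j)⟩

lemma abs_ciSup_le {ι : Type*} [Nonempty ι] {a : ι → ℝ} {C : ℝ} (ha : ∀ j, |a j| ≤ C) :
    |⨆ j, a j| ≤ C := by
  refine abs_le.2 ⟨?_, ciSup_le fun j ↦ le_of_abs_le (ha j)⟩
  let j := Classical.arbitrary ι
  exact (neg_le_of_abs_le (ha j)).trans (le_ciSup (bddAbove_range_of_abs_le ha) j)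

lemma MeasureTheory.MeasurePreserving.integral_comp_of_measurable {Ω Ω' : Type*}
    [MeasurableSpace Ω] [MeasurableSpace Ω'] {μ : Measure Ω} {ν : Measure Ω'} {φ : Ω → Ω'}
    (hφ : MeasurePreserving φ μ ν) {g : Ω' → ℝ} (hg : Measurable g) :
    ∫ ω, g (φ ω) ∂μ = ∫ ω, g ω ∂ν := by
  rw [← hφ.map_eq, integral_map hφ.measurable.aemeasurable hg.aestronglyMeasurable]

lemma measurePreserving_not_uniform :
    MeasurePreserving not (PMF.uniformOfFintype Bool).toMeasure
      (PMF.uniformOfFintype Bool).toMeasure := by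
  refine ⟨measurable_of_finite _, Measure.ext_of_singleton fun b ↦ ?_⟩
  have : not ⁻¹' {b} = {!b} := by ext; cases b <;> simp
  rw [Measure.map_apply (measurable_of_finite _) (measurableSet_singleton b), this,
    PMF.toMeasure_apply_singleton _ _ (measurableSet_singleton _),
    PMF.toMeasure_apply_singleton _ _ (measurableSet_singleton _)]
  simp

lemma measurePreserving_swap_coords {Z : Type*} [MeasurableSpace Z] (μ : Measure Z)
    [IsProbabilityMeasure μ] {n : ℕ} (σ : Fin n → Bool) :
    MeasurePreserving (fun (W : Fin n → Z × Z) i ↦ if σ i then W i else (W i).swap)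
      (Measure.pi fun _ ↦ μ.prod μ) (Measure.pi fun _ ↦ μ.prod μ) := by
  refine measurePreserving_pi (f := fun i (w : Z × Z) ↦ if σ i then w else w.swap) _ _ fun i ↦ ?_
  by_cases h : σ i
  · simpa [h] using! MeasurePreserving.id (μ.prod μ)
  · simpa [h] using Measure.measurePreserving_swap (μ := μ) (ν := μ)

lemma abs_deviation_le {Z : Type*} [MeasurableSpace Z] {a : Z → ℝ} (ha : ∀ z, |a z| ≤ 1)
    (μ : Measure Z) [IsProbabilityMeasure μ] {n : ℕ} (D : Fin n → Z) :
    |∫ z, a z ∂μ - (n : ℝ)⁻¹ * ∑ i, a (D i)| ≤ 2 := by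
  have h1 : |∫ z, a z ∂μ| ≤ 1 := by
    simpa using norm_integral_le_of_norm_le_const (μ := μ) (f := a) (C := 1) (.of_forall ha)
  have h2 := abs_mean_le (n := n) zero_le_one fun i ↦ ha (D i)
  exact (abs_sub _ _).trans (by linarith)

lemma integrable_mean {Z : Type*} [MeasurableSpace Z] {a : Z → ℝ} (ham : Measurable a)
    (ha : ∀ z, |a z| ≤ 1) (μ : Measure Z) [IsProbabilityMeasure μ] (n : ℕ) :
    Integrable (fun D : Fin n → Z ↦ (n : ℝ)⁻¹ * ∑ i, a (D i)) (Measure.pi fun _ ↦ μ) :=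
  Measurable.integrable_of_abs_le (by fun_prop) fun D ↦
    abs_mean_le zero_le_one fun i ↦ ha (D i)

/-- The empirical mean is unbiased. -/
lemma integral_mean_eq {Z : Type*} [MeasurableSpace Z] {a : Z → ℝ} (ham : Measurable a)
    (ha : ∀ z, |a z| ≤ 1) (μ : Measure Z) [IsProbabilityMeasure μ] {n : ℕ} (hn : 0 < n) :
    ∫ D, (n : ℝ)⁻¹ * ∑ i, a (D i) ∂(Measure.pi fun _ : Fin n ↦ μ) = ∫ z, a z ∂μ := by
  have hn' : (n : ℝ) ≠ 0 := by exact_mod_cast hn.ne'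
  have hcoord (i : Fin n) : ∫ D, a (D i) ∂(Measure.pi fun _ : Fin n ↦ μ) = ∫ z, a z ∂μ :=
    integral_comp_eval (μ := fun _ : Fin n ↦ μ) ham.aestronglyMeasurable
  rw [integral_const_mul, integral_finsetSum _ fun i _ ↦
    Measurable.integrable_of_abs_le (by fun_prop) fun D ↦ ha (D i)]
  simp [hcoord, hn']

variable {ι Z : Type*} [Countable ι] [Nonempty ι] [MeasurableSpace Z] {f : ι → Z → ℝ} {n : ℕ}

lemma integral_ghost_sample_le (hfm : ∀ j, Measurable (f j)) (hf : ∀ j z, |f j z| ≤ 1)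
    (μ : Measure Z) [IsProbabilityMeasure μ] (hn : 0 < n) :
    ∫ D, ⨆ j, (∫ z, f j z ∂μ - (n : ℝ)⁻¹ * ∑ i, f j (D i)) ∂(Measure.pi fun _ : Fin n ↦ μ)
      ≤ ∫ W, ⨆ j, (n : ℝ)⁻¹ * ∑ i, (f j (W i).2 - f j (W i).1)
          ∂(Measure.pi fun _ : Fin n ↦ μ.prod μ) := by
  set P : Measure (Fin n → Z) := Measure.pi fun _ ↦ μ
  let S : (Fin n → Z) × (Fin n → Z) → ℝ := fun q ↦
    ⨆ j, (n : ℝ)⁻¹ * ∑ i, (f j (q.2 i) - f j (q.1 i))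
  have hterm (q : (Fin n → Z) × (Fin n → Z)) (j : ι) :
      |(n : ℝ)⁻¹ * ∑ i, (f j (q.2 i) - f j (q.1 i))| ≤ 2 :=
    abs_mean_le (by norm_num) fun i ↦ (abs_sub _ _).trans (by linarith [hf j (q.2 i), hf j (q.1 i)])
  have hSm : Measurable S := by fun_prop
  have hSB (q) : |S q| ≤ 2 := abs_ciSup_le (hterm q)
  have hS : Integrable S (P.prod P) := hSm.integrable_of_abs_le hSB
  have hL : Integrable (fun D ↦ ⨆ j, (∫ z, f j z ∂μ - (n : ℝ)⁻¹ * ∑ i, f j (D i))) P :=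
    Measurable.integrable_of_abs_le (by fun_prop) fun D ↦
      abs_ciSup_le fun j ↦ abs_deviation_le (hf j) μ D
  have hmp := measurePreserving_arrowProdEquivProdArrow Z Z (Fin n) (fun _ ↦ μ) (fun _ ↦ μ)
  calc _ ≤ ∫ D, ∫ D', S (D, D') ∂P ∂P := by
        refine integral_mono hL hS.integral_prod_left fun D ↦ ciSup_le fun j ↦ ?_
        calc ∫ z, f j z ∂μ - (n : ℝ)⁻¹ * ∑ i, f j (D i)
            = ∫ D', (n : ℝ)⁻¹ * ∑ i, (f j (D' i) - f j (D i)) ∂P := by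
              simp_rw [Finset.sum_sub_distrib, mul_sub]
              rw [integral_sub (integrable_mean (hfm j) (hf j) μ n) (integrable_const _),
                integral_mean_eq (hfm j) (hf j) μ hn, integral_const, probReal_univ, one_smul]
          _ ≤ ∫ D', S (D, D') ∂P := by
              refine integral_mono (Measurable.integrable_of_abs_le (by fun_prop)
                fun D' ↦ hterm (D, D') j)
                ((hSm.comp measurable_prodMk_left).integrable_of_abs_le fun D' ↦ hSB (D, D'))
                fun D' ↦ le_ciSup (bddAbove_range_of_abs_le (hterm (D, D'))) j
    _ = ∫ q, S q ∂(P.prod P) := (integral_prod _ hS).symm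
    _ = _ := (hmp.integral_comp' S).symm

/-- **Symmetrization**: the expected uniform deviation is at most twice the Rademacher
complexity. -/
lemma integral_iSup_deviation_le (hfm : ∀ j, Measurable (f j)) (hf : ∀ j z, |f j z| ≤ 1)
    (μ : Measure Z) [IsProbabilityMeasure μ] (hn : 0 < n) :
    ∫ D, ⨆ j, (∫ z, f j z ∂μ - (n : ℝ)⁻¹ * ∑ i, f j (D i)) ∂(Measure.pi fun _ : Fin n ↦ μ)
      ≤ 2 * ∫ D, ∫ σ, ⨆ j, (n : ℝ)⁻¹ * ∑ i, (if σ i then (1 : ℝ) else -1) * f j (D i)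
          ∂(Measure.pi fun _ : Fin n ↦ (PMF.uniformOfFintype Bool).toMeasure)
          ∂(Measure.pi fun _ : Fin n ↦ μ) := by
  refine (integral_ghost_sample_le hfm hf μ hn).trans ?_
  set P : Measure (Fin n → Z) := Measure.pi fun _ ↦ μ
  set Q : Measure (Fin n → Z × Z) := Measure.pi fun _ ↦ μ.prod μ
  set ν := (PMF.uniformOfFintype Bool).toMeasure
  set N : Measure (Fin n → Bool) := Measure.pi fun _ ↦ ν
  let r : (Fin n → Bool) → (Fin n → Z) → ℝ := fun σ D ↦
    ⨆ j, (n : ℝ)⁻¹ * ∑ i, (if σ i then (1 : ℝ) else -1) * f j (D i)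
  let S : (Fin n → Z × Z) → ℝ := fun W ↦ ⨆ j, (n : ℝ)⁻¹ * ∑ i, (f j (W i).2 - f j (W i).1)
  change ∫ W, S W ∂Q ≤ 2 * ∫ D, ∫ σ, r σ D ∂N ∂P
  have hterm (σ : Fin n → Bool) (D : Fin n → Z) (j : ι) :
      |(n : ℝ)⁻¹ * ∑ i, (if σ i then (1 : ℝ) else -1) * f j (D i)| ≤ 1 :=
    abs_mean_le zero_le_one fun i ↦ by split_ifs <;> simpa using hf j (D i)
  have hrB (σ D) : |r σ D| ≤ 1 := abs_ciSup_le (hterm σ D)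
  have hrm (σ) : Measurable (r σ) := by fun_prop
  have hr : Measurable (Function.uncurry r) := measurable_from_prod_countable_right hrm
  have hri : Integrable (Function.uncurry r) (N.prod P) :=
    hr.integrable_of_abs_le fun q ↦ hrB q.1 q.2
  have hSm : Measurable S := by fun_prop
  have hfst : MeasurePreserving (fun (W : Fin n → Z × Z) i ↦ (W i).1) Q P :=
    measurePreserving_pi (f := fun _ ↦ Prod.fst) _ _ fun _ ↦ measurePreserving_fst
  have hsnd : MeasurePreserving (fun (W : Fin n → Z × Z) i ↦ (W i).2) Q P :=
    measurePreserving_pi (f := fun _ ↦ Prod.snd) _ _ fun _ ↦ measurePreserving_snd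
  have hnot : MeasurePreserving (fun (σ : Fin n → Bool) i ↦ !σ i) N N :=
    measurePreserving_pi (f := fun _ ↦ not) _ _ fun _ ↦ measurePreserving_not_uniform
  have hswap (σ : Fin n → Bool) :
      ∫ W, S W ∂Q ≤ ∫ D, r σ D ∂P + ∫ D, r (fun i ↦ !σ i) D ∂P := by
    have hT := measurePreserving_swap_coords μ σ
    have hi1 : Integrable (fun W : Fin n → Z × Z ↦ r σ fun i ↦ (W i).2) Q :=
      ((hrm σ).comp hsnd.measurable).integrable_of_abs_le fun W ↦ hrB _ _
    have hi2 : Integrable (fun W : Fin n → Z × Z ↦ r (fun i ↦ !σ i) fun i ↦ (W i).1) Q :=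
      ((hrm _).comp hfst.measurable).integrable_of_abs_le fun W ↦ hrB _ _
    have hle (W : Fin n → Z × Z) : S (fun i ↦ if σ i then W i else (W i).swap)
        ≤ r σ (fun i ↦ (W i).2) + r (fun i ↦ !σ i) fun i ↦ (W i).1 := by
      refine ciSup_le fun j ↦ ?_
      have h1 := le_ciSup (bddAbove_range_of_abs_le (hterm σ fun i ↦ (W i).2)) j
      have h2 := le_ciSup (bddAbove_range_of_abs_le (hterm (fun i ↦ !σ i) fun i ↦ (W i).1)) j
      refine le_trans (le_of_eq ?_) (add_le_add h1 h2)
      rw [← mul_add, ← Finset.sum_add_distrib]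
      congr with i
      cases h : σ i <;> simp [h] <;> ring
    have hSB (W) : |S W| ≤ 2 := abs_ciSup_le fun j ↦ abs_mean_le (by norm_num) fun i ↦
      (abs_sub _ _).trans (by linarith [hf j (W i).2, hf j (W i).1])
    calc ∫ W, S W ∂Q = ∫ W, S (fun i ↦ if σ i then W i else (W i).swap) ∂Q :=
          (hT.integral_comp_of_measurable hSm).symm
      _ ≤ ∫ W, (r σ (fun i ↦ (W i).2) + r (fun i ↦ !σ i) fun i ↦ (W i).1) ∂Q :=
          integral_mono ((hSm.comp hT.measurable).integrable_of_abs_le fun W ↦ hSB _)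
            (hi1.add hi2) hle
      _ = _ := by rw [integral_add hi1 hi2, hsnd.integral_comp_of_measurable (hrm _),
            hfst.integral_comp_of_measurable (hrm _)]
  have hRi : Integrable (fun σ ↦ ∫ D, r σ D ∂P) N := hri.integral_prod_left
  have hRi' : Integrable (fun σ : Fin n → Bool ↦ ∫ D, r (fun i ↦ !σ i) D ∂P) N :=
    hnot.integrable_comp_of_integrable hRi
  have hRnot : ∫ σ : Fin n → Bool, ∫ D, r (fun i ↦ !σ i) D ∂P ∂N = ∫ σ, ∫ D, r σ D ∂P ∂N :=
    hnot.integral_comp_of_measurable (measurable_of_finite fun σ ↦ ∫ D, r σ D ∂P)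
  calc ∫ W, S W ∂Q = ∫ _σ, ∫ W, S W ∂Q ∂N := by simp
    _ ≤ ∫ σ, (∫ D, r σ D ∂P + ∫ D, r (fun i ↦ !σ i) D ∂P) ∂N :=
        integral_mono (integrable_const _) (hRi.add hRi') hswap
    _ = 2 * ∫ σ, ∫ D, r σ D ∂P ∂N := by rw [integral_add hRi hRi', hRnot, two_mul]
    _ = 2 * ∫ D, ∫ σ, r σ D ∂N ∂P := by rw [integral_integral_swap hri]

lemma integral_iSup_rademacher_nonneg (hfm : ∀ j, Measurable (f j)) (hf : ∀ j z, |f j z| ≤ 1)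
    (μ : Measure Z) [IsProbabilityMeasure μ] (hn : 0 < n) :
    0 ≤ ∫ D, ∫ σ, ⨆ j, (n : ℝ)⁻¹ * ∑ i, (if σ i then (1 : ℝ) else -1) * f j (D i)
          ∂(Measure.pi fun _ : Fin n ↦ (PMF.uniformOfFintype Bool).toMeasure)
          ∂(Measure.pi fun _ : Fin n ↦ μ) := by
  have hsymm := integral_iSup_deviation_le hfm hf μ hn
  set P : Measure (Fin n → Z) := Measure.pi fun _ ↦ μ
  let k := Classical.arbitrary ι
  have hk : ∫ D, (∫ z, f k z ∂μ - (n : ℝ)⁻¹ * ∑ i, f k (D i)) ∂P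
      ≤ ∫ D, ⨆ j, (∫ z, f j z ∂μ - (n : ℝ)⁻¹ * ∑ i, f j (D i)) ∂P :=
    integral_mono
      (Measurable.integrable_of_abs_le (by fun_prop) fun D ↦ abs_deviation_le (hf k) μ D)
      (Measurable.integrable_of_abs_le (by fun_prop) fun D ↦
        abs_ciSup_le fun j ↦ abs_deviation_le (hf j) μ D)
      fun D ↦ le_ciSup (bddAbove_range_of_abs_le fun j ↦ abs_deviation_le (hf j) μ D) k
  rw [integral_sub (integrable_const _) (integrable_mean (hfm k) (hf k) μ n),
    integral_mean_eq (hfm k) (hf k) μ hn,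
    integral_const, probReal_univ, one_smul, sub_self] at hk
  linarith

end Symmetrization

section Tail

lemma abs_mean_update_sub_le {Z : Type*} {n : ℕ} {a : Z → ℝ} (ha : ∀ z, a z ∈ Set.Icc (0 : ℝ) 1)
    (D : Fin n → Z) (i : Fin n) (z : Z) :
    |(n : ℝ)⁻¹ * ∑ k, a (Function.update D i z k) - (n : ℝ)⁻¹ * ∑ k, a (D k)| ≤ (n : ℝ)⁻¹ := by
  have hsum : ∑ k, a (Function.update D i z k) - ∑ k, a (D k) = a z - a (D i) := by
    rw [← Finset.sum_sub_distrib, Finset.sum_eq_single i (fun k _ hk ↦ by simp [hk]) (by simp)]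
    simp
  rw [← mul_sub, hsum, abs_mul, abs_of_nonneg (by positivity)]
  refine mul_le_of_le_one_right (by positivity) (abs_le.2 ?_)
  have h1 := ha z
  have h2 := ha (D i)
  constructor <;> linarith [h1.1, h1.2, h2.1, h2.2]

variable {ι Z : Type*} [Countable ι] [Nonempty ι] [MeasurableSpace Z] {f : ι → Z → ℝ} {n : ℕ}

/-- Upper tail of the uniform deviation, corrected by the deviation of a fixed function. -/
lemma measureReal_iSup_deviation_add_ge_le (hfm : ∀ j, Measurable (f j))
    (hf : ∀ j z, f j z ∈ Set.Icc (0 : ℝ) 1) (μ : Measure Z) [IsProbabilityMeasure μ] (hn : 0 < n)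
    (k : ι) {ε : ℝ} (hε : 0 ≤ ε) :
    (Measure.pi fun _ : Fin n ↦ μ).real
      {D | 2 * (∫ D, ∫ σ, ⨆ j, (n : ℝ)⁻¹ * ∑ i, (if σ i then (1 : ℝ) else -1) * f j (D i)
          ∂(Measure.pi fun _ : Fin n ↦ (PMF.uniformOfFintype Bool).toMeasure)
          ∂(Measure.pi fun _ : Fin n ↦ μ)) + ε
        ≤ (⨆ j, (∫ z, f j z ∂μ - (n : ℝ)⁻¹ * ∑ i, f j (D i)))
          + ((n : ℝ)⁻¹ * ∑ i, f k (D i) - ∫ z, f k z ∂μ)} ≤ exp (-(n * ε ^ 2 / 2)) := by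
  have hf' (j z) : |f j z| ≤ 1 := abs_le.2 ⟨by linarith [(hf j z).1], (hf j z).2⟩
  have hsymm := integral_iSup_deviation_le hfm hf' μ hn
  set P : Measure (Fin n → Z) := Measure.pi fun _ ↦ μ
  set R := ∫ D, ∫ σ, ⨆ j, (n : ℝ)⁻¹ * ∑ i, (if σ i then (1 : ℝ) else -1) * f j (D i)
    ∂(Measure.pi fun _ : Fin n ↦ (PMF.uniformOfFintype Bool).toMeasure) ∂P
  let Φ : (Fin n → Z) → ℝ := fun D ↦ ⨆ j, (∫ z, f j z ∂μ - (n : ℝ)⁻¹ * ∑ i, f j (D i))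
  let Ψ : (Fin n → Z) → ℝ := fun D ↦ (n : ℝ)⁻¹ * ∑ i, f k (D i) - ∫ z, f k z ∂μ
  have hterm (D : Fin n → Z) (j) : |∫ z, f j z ∂μ - (n : ℝ)⁻¹ * ∑ i, f j (D i)| ≤ 2 :=
    abs_deviation_le (hf' j) μ D
  have hΦm : Measurable Φ := by fun_prop
  have hΨm : Measurable Ψ := by fun_prop
  have hΦB (D) : |Φ D| ≤ 2 := abs_ciSup_le (hterm D)
  have hΨB (D) : |Ψ D| ≤ 2 := by rw [abs_sub_comm]; exact hterm D k
  have hΨ0 : ∫ D, Ψ D ∂P = 0 := by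
    rw [integral_sub (integrable_mean (hfm k) (hf' k) μ n) (integrable_const _),
      integral_mean_eq (hfm k) (hf' k) μ hn, integral_const, probReal_univ, one_smul, sub_self]
  have hmean : ∫ D, (Φ D + Ψ D) ∂P ≤ 2 * R := by
    rw [integral_add (hΦm.integrable_of_abs_le hΦB) (hΨm.integrable_of_abs_le hΨB), hΨ0, add_zero]
    exact hsymm
  have hdiff (D : Fin n → Z) (i : Fin n) (z : Z) : Φ (Function.update D i z)
      + Ψ (Function.update D i z) ≤ Φ D + Ψ D + ((2 / n : NNReal) : ℝ) := by
    have h1 : Φ (Function.update D i z) ≤ Φ D + (n : ℝ)⁻¹ := by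
      refine ciSup_le fun j ↦ ?_
      have := le_ciSup (bddAbove_range_of_abs_le (hterm D)) j
      linarith [(abs_le.1 (abs_mean_update_sub_le (hf j) D i z)).1]
    have h2 := (abs_le.1 (abs_mean_update_sub_le (hf k) D i z)).2
    have h3 : ((2 / n : NNReal) : ℝ) = (n : ℝ)⁻¹ + (n : ℝ)⁻¹ := by push_cast; ring
    rw [h3]
    simp only [Ψ]
    linarith
  have htail := (hasSubgaussianMGF_of_bounded_differences_s15 μ (hΦm.add hΨm) (B := 4)
    (fun D ↦ (abs_add_le _ _).trans (by linarith [hΦB D, hΨB D])) hdiff).measure_ge_le hε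
  refine (measureReal_mono fun D (hD : 2 * R + ε ≤ Φ D + Ψ D) ↦ ?_).trans (htail.trans_eq ?_)
  · change ε ≤ Φ D + Ψ D - ∫ D, (Φ D + Ψ D) ∂P
    linarith
  · congr 1
    simp
    field_simp

end Tail

/-- **PAC bound via Rademacher complexity.** For a countable nonempty class `H` of measurable
hypotheses and a `[0,1]`-valued loss, with `h*` an expected risk minimiser and `ĥ` an
empirical risk minimiser over `H`, for every `δ ∈ (0,1)`, with probability at least `1 - δ`
over the `n` i.i.d. training samples,
`L(ĥ) - L(h*) ≤ 4 R_n(A) + √(2 log (2/δ) / n)`, where `A = {z ↦ l(z,h) : h ∈ H}` is the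
loss class. -/
theorem pac_rademacher_bound
    {n : ℕ} (hn : 0 < n)
    (H : Set (X → Y)) (hH : H.Nonempty) (hHc : H.Countable)
    (l : X × Y → (X → Y) → ℝ) (hl : ∀ z h, l z h ∈ Set.Icc (0 : ℝ) 1)
    (hmeas : ∀ h ∈ H, Measurable fun z => l z h)
    (p : Measure (X × Y)) [IsProbabilityMeasure p]
    (hstar : X → Y) (hstarmem : hstar ∈ H)
    (hstaropt : ∀ h ∈ H, expRisk p l hstar ≤ expRisk p l h)
    (erm : (Fin n → X × Y) → X → Y)
    (herm : ∀ D : Fin n → X × Y,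
      erm D ∈ H ∧ ∀ h ∈ H, empRisk l D (erm D) ≤ empRisk l D h)
    (δ : ℝ) (hδ : δ ∈ Set.Ioo (0 : ℝ) 1) :
    1 - δ ≤
      ((Measure.pi fun _ : Fin n => p)
        {D | expRisk p l (erm D) - expRisk p l hstar
          ≤ 4 * rademacherComplexity n p ((fun h : X → Y => fun z => l z h) '' H)
            + Real.sqrt (2 * Real.log (2 / δ) / n)}).toReal := by
  have : Nonempty H := hH.to_subtype
  have : Countable H := hHc
  have hf (h : H) (z : X × Y) := hl z h
  have hfm (h : H) : Measurable fun z ↦ l z h := hmeas h h.2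
  have hn' : (0 : ℝ) < n := by exact_mod_cast hn
  have hδ2 : 1 < 2 / δ := (one_lt_div hδ.1).2 (by linarith [hδ.2])
  set ε := √(2 * log (2 / δ) / n)
  have hε2 : ε ^ 2 = 2 * log (2 / δ) / n :=
    sq_sqrt (div_nonneg (mul_nonneg zero_le_two (log_pos hδ2).le) hn'.le)
  have hR : rademacherComplexity n p ((fun h : X → Y ↦ fun z ↦ l z h) '' H)
      = ∫ D, ∫ σ, ⨆ h : H, (n : ℝ)⁻¹ * ∑ i, (if σ i then (1 : ℝ) else -1) * l (D i) h
          ∂(Measure.pi fun _ : Fin n ↦ (PMF.uniformOfFintype Bool).toMeasure)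
          ∂(Measure.pi fun _ : Fin n ↦ p) := by
    unfold rademacherComplexity
    congr with D
    congr with σ
    exact ((Set.imageFactorization_surjective
      (f := fun (h : X → Y) (z : X × Y) ↦ l z h) (s := H)).iSup_comp _).symm
  have hR0 := integral_iSup_rademacher_nonneg (n := n) hfm
    (fun h z ↦ abs_le.2 ⟨by linarith [(hf h z).1], (hf h z).2⟩) p hn
  have htail := measureReal_iSup_deviation_add_ge_le hfm hf p hn ⟨hstar, hstarmem⟩
    (sqrt_nonneg _ : 0 ≤ ε)
  have hexp : exp (-(n * ε ^ 2 / 2)) ≤ δ := by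
    rw [hε2, show n * (2 * log (2 / δ) / n) / 2 = log (2 / δ) by field_simp, exp_neg,
      exp_log (by linarith), inv_div]
    linarith [hδ.1]
  rw [hR]
  set R := ∫ D, ∫ σ, ⨆ h : H, (n : ℝ)⁻¹ * ∑ i, (if σ i then (1 : ℝ) else -1) * l (D i) h
    ∂(Measure.pi fun _ : Fin n ↦ (PMF.uniformOfFintype Bool).toMeasure)
    ∂(Measure.pi fun _ : Fin n ↦ p)
  set P : Measure (Fin n → X × Y) := Measure.pi fun _ ↦ p
  set bad : Set (Fin n → X × Y) := {D | 2 * R + ε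
    ≤ (⨆ h : H, (∫ z, l z h ∂p - (n : ℝ)⁻¹ * ∑ i, l (D i) h))
      + ((n : ℝ)⁻¹ * ∑ i, l (D i) hstar - ∫ z, l z hstar ∂p)}
  have hgood : badᶜ ⊆ {D | expRisk p l (erm D) - expRisk p l hstar ≤ 4 * R + ε} := by
    intro D hD
    simp only [bad, Set.mem_compl_iff, Set.mem_ofPred_eq, not_le] at hD
    have hsup := le_ciSup (f := fun h : H ↦ ∫ z, l z h ∂p - (n : ℝ)⁻¹ * ∑ i, l (D i) h)
      (bddAbove_range_of_abs_le fun h ↦ abs_deviation_le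
        (fun z ↦ abs_le.2 ⟨by linarith [(hf h z).1], (hf h z).2⟩) p D) ⟨erm D, (herm D).1⟩
    have hemp := (herm D).2 hstar hstarmem
    simp only [empRisk] at hemp
    simp only [Set.mem_ofPred_eq, expRisk]
    linarith
  have hcover : 1 ≤ P.real bad + P.real badᶜ := by
    rw [← probReal_univ (μ := P), ← Set.union_compl_self bad]
    exact measureReal_union_le _ _
  have hmono := measureReal_mono (μ := P) hgood
  change _ ≤ P.real _
  linarith
end
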